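/- Let f and g be monotone bifunctions on K with f an upper hemicontinuous equilibrium bifunction, and assume that for each y ∈ K there exists x* ∈ H with g(y,z) ≥ ⟨x*, z − y⟩ for all z ∈ K. Let (xₙ) be a sequence generated by the inertial proximal algorithm (IPA) which is bounded and satisfies ‖x_{n+1} − xₙ‖ → 0 and ‖x_{n+1} − yₙ‖ → 0 (where yₙ := xₙ + α(xₙ − x_{n−1})). If βₙ → +∞ and liminf_{n→∞} λₙ > 0, then every weak sequential cluster point of (xₙ) belongs to S_f. -/

import Mathlib

open RealInnerProductSpace Filter Topology

variable {H : Type*} [NormedAddCommGroup H] [InnerProductSpace ℝ H]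

/-- The solution set of the lower-level equilibrium problem: `S_f = {u ∈ K : f(u,y) ≥ 0 ∀ y ∈ K}`. -/
def Sf (K : Set H) (f : H → H → ℝ) : Set H := {u ∈ K | ∀ y ∈ K, 0 ≤ f u y}

/-- The solution set of the bilevel equilibrium problem:
`S = {x̄ ∈ S_f : g(x̄,y) ≥ 0 ∀ y ∈ S_f}`. -/
def Sol (K : Set H) (f g : H → H → ℝ) : Set H :=
  {u ∈ Sf K f | ∀ y ∈ Sf K f, 0 ≤ g u y}

/-- `p` belongs to the normal cone of `C` at `u`. -/
def InNormalCone (C : Set H) (u p : H) : Prop :=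
  u ∈ C ∧ ∀ z ∈ C, ⟪p, z - u⟫ ≤ 0

/-- `x` is a sequence generated by the inertial proximal algorithm (IPA). -/
def IPA (K : Set H) (f g : H → H → ℝ) (α : ℝ) (lam beta : ℕ → ℝ) (x : ℕ → H) : Prop :=
  (∀ n, x n ∈ K) ∧
  ∀ n, 1 ≤ n → ∀ y ∈ K,
    0 ≤ beta n * f (x (n + 1)) y + g (x (n + 1)) y +
      (1 / lam n) * ⟪x (n + 1) - (x n + α • (x n - x (n - 1))), y - x (n + 1)⟫

/-- The geometric condition (GC) for a pair `(u, p)` with `p ∈ N_{S_f}(u)`: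
for every `n` the supremum `Fₙ = sup_{y ∈ K} (⟨(2/βₙ)p, y⟩ + f(y,u))` is finite and the series
`∑ₙ λₙβₙ (Fₙ − (2/βₙ)⟨p,u⟩)` converges. -/
def GC (K : Set H) (f : H → H → ℝ) (lam beta : ℕ → ℝ) (u p : H) : Prop :=
  ∃ F : ℕ → ℝ,
    (∀ n, IsLUB {r : ℝ | ∃ y ∈ K, r = ⟪(2 / beta n) • p, y⟫ + f y u} (F n)) ∧
    Summable (fun n => lam n * beta n * (F n - (2 / beta n) * ⟪p, u⟫))

/-- `h` is upper hemicontinuous on `K`: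
`limsup_{t→0⁺} h(tz + (1−t)x, y) ≤ h(x,y)` for all `x, y, z ∈ K`. -/
def UpperHemicontinuousBifunOn {H : Type*} [NormedAddCommGroup H] [InnerProductSpace ℝ H]
    (K : Set H) (h : H → H → ℝ) : Prop :=
  ∀ x ∈ K, ∀ y ∈ K, ∀ z ∈ K,
    Filter.limsup (fun t : ℝ => h (t • z + (1 - t) • x) y) (nhdsWithin 0 (Set.Ioi 0)) ≤ h x y

/-- `h` is an equilibrium bifunction on `K`: `h(x,x) = 0` and `h(x,·)` is convex and lower
semicontinuous on `K`, for every `x ∈ K`. -/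
def EquilibriumBifun {H : Type*} [NormedAddCommGroup H] [InnerProductSpace ℝ H]
    (K : Set H) (h : H → H → ℝ) : Prop :=
  ∀ x ∈ K, h x x = 0 ∧ ConvexOn ℝ K (h x) ∧ LowerSemicontinuousOn (h x) K

/-- A closed convex set is weakly sequentially closed. -/
lemma mem_of_isClosed_convex_of_tendsto_inner [CompleteSpace H] {C : Set H}
    (hcl : IsClosed C) (hcv : Convex ℝ C) {u : ℕ → H} {a : H}
    (hu : ∀ z : H, Tendsto (fun k => ⟪u k, z⟫) atTop (𝓝 ⟪a, z⟫))
    (hC : ∀ᶠ k in atTop, u k ∈ C) : a ∈ C := by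
  by_contra ha
  obtain ⟨l, r, hlr, hC'⟩ := geometric_hahn_banach_point_closed hcv hcl ha
  have hl : ∀ w, ⟪w, (InnerProductSpace.toDual ℝ H).symm l⟫ = l w := fun w => by
    rw [real_inner_comm, InnerProductSpace.toDual_symm_apply]
  have h := hu ((InnerProductSpace.toDual ℝ H).symm l)
  simp only [hl] at h
  exact absurd hlr (not_lt.2 (ge_of_tendsto h (hC.mono fun k hk => (hC' _ hk).le)))

/-- Minty's lemma: a solution of the dual equilibrium problem solves the primal one. -/
lemma mem_Sf_of_forall_nonpos {K : Set H} (hKcv : Convex ℝ K) {f : H → H → ℝ}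
    (hfUHC : UpperHemicontinuousBifunOn K f) (hfEq : EquilibriumBifun K f)
    {u : H} (hu : u ∈ K) (h : ∀ y ∈ K, f y u ≤ 0) : u ∈ Sf K f := by
  refine ⟨hu, fun y hy => le_trans ?_ (hfUHC u hu y hy y hy)⟩
  have hpos : ∀ t ∈ Set.Ioo (0 : ℝ) 1, 0 ≤ f (t • y + (1 - t) • u) y := by
    rintro t ⟨ht0, ht1⟩
    have hmem : t • y + (1 - t) • u ∈ K :=
      hKcv hy hu ht0.le (sub_nonneg.2 ht1.le) (by ring)
    obtain ⟨h0, hcv, -⟩ := hfEq _ hmem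
    have h1 := hcv.2 hy hu ht0.le (sub_nonneg.2 ht1.le) (by ring)
    rw [h0, smul_eq_mul, smul_eq_mul] at h1
    have h2 := mul_nonpos_of_nonneg_of_nonpos (sub_nonneg.2 ht1.le) (h _ hmem)
    exact nonneg_of_mul_nonneg_right (by linarith) ht0
  rw [limsup_eq]
  refine Real.sInf_nonneg fun b hb => ?_
  obtain ⟨t, ht, hle⟩ := (Eventually.and (Ioo_mem_nhdsGT zero_lt_one) hb).exists
  exact (hpos t ht).trans hle

/-- Along a bounded sequence generated by (IPA), `f y (x n)` is asymptotically nonpositive. -/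
lemma IPA.eventually_le {K : Set H} {f g : H → H → ℝ} {α : ℝ} {lam beta : ℕ → ℝ} {x : ℕ → H}
    (hx : IPA K f g α lam beta x)
    (hfmono : ∀ x ∈ K, ∀ y ∈ K, f x y + f y x ≤ 0)
    (hgmono : ∀ x ∈ K, ∀ y ∈ K, g x y + g y x ≤ 0)
    (hgsub : ∀ y ∈ K, ∃ xs : H, ∀ z ∈ K, ⟪xs, z - y⟫ ≤ g y z)
    (hbdd : ∃ M : ℝ, ∀ n, ‖x n‖ ≤ M)
    (hinert : Tendsto (fun n => ‖x (n + 1) - (x n + α • (x n - x (n - 1)))‖) atTop (𝓝 0))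
    (hbetaTop : Tendsto beta atTop atTop)
    (hlaminf : ∃ c > (0 : ℝ), ∀ᶠ n in atTop, c ≤ lam n)
    {y : H} (hy : y ∈ K) {ε : ℝ} (hε : 0 < ε) : ∀ᶠ n in atTop, f y (x n) ≤ ε := by
  obtain ⟨M, hM⟩ := hbdd
  obtain ⟨c, hc, hlam⟩ := hlaminf
  obtain ⟨p, hp⟩ := hgsub y hy
  suffices h : ∀ᶠ n in atTop, f y (x (n + 1)) ≤ ε by
    rw [← map_add_atTop_eq_nat 1]
    exact h
  have hnear := hinert.eventually_lt_const hc
  have hbig := hbetaTop.eventually_ge_atTop ((‖p‖ + 1) * (M + ‖y‖) / ε)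
  filter_upwards [hlam, hnear, hbig, hbetaTop.eventually_gt_atTop 0, eventually_ge_atTop 1]
    with n hlam hnear hbig hbeta hn
  have hmem := hx.1 (n + 1)
  have hipa := hx.2 n hn y hy
  set d := x (n + 1) - (x n + α • (x n - x (n - 1)))
  have hdist : ‖y - x (n + 1)‖ ≤ M + ‖y‖ := by
    linarith [norm_sub_le y (x (n + 1)), hM (n + 1)]
  have hg : g (x (n + 1)) y ≤ ‖p‖ * (M + ‖y‖) := by
    have h1 : ⟪p, y - x (n + 1)⟫ ≤ ‖p‖ * (M + ‖y‖) :=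
      (real_inner_le_norm _ _).trans (by gcongr)
    have h2 := hp _ hmem
    rw [← neg_sub, inner_neg_right] at h2
    linarith [hgmono _ hmem y hy]
  have hin : (1 / lam n) * ⟪d, y - x (n + 1)⟫ ≤ M + ‖y‖ := by
    have hl : 0 < lam n := hc.trans_le hlam
    rw [one_div, inv_mul_le_iff₀ hl]
    refine (real_inner_le_norm _ _).trans ?_
    gcongr
    exact hnear.le.trans hlam
  rw [div_le_iff₀ hε] at hbig
  have hf := mul_le_mul_of_nonneg_left (hfmono _ hmem y hy) hbeta.le
  refine le_of_mul_le_mul_left ?_ hbeta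
  linarith

theorem stmt6 {H : Type*} [NormedAddCommGroup H] [InnerProductSpace ℝ H] [CompleteSpace H]
    (K : Set H) (hKne : K.Nonempty) (hKcl : IsClosed K) (hKcv : Convex ℝ K)
    (f g : H → H → ℝ)
    (hfmono : ∀ x ∈ K, ∀ y ∈ K, f x y + f y x ≤ 0)
    (hgmono : ∀ x ∈ K, ∀ y ∈ K, g x y + g y x ≤ 0)
    (hfUHC : UpperHemicontinuousBifunOn K f) (hfEq : EquilibriumBifun K f)
    (hgsub : ∀ y ∈ K, ∃ xs : H, ∀ z ∈ K, ⟪xs, z - y⟫ ≤ g y z)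
    (α : ℝ) (hα0 : 0 ≤ α) (hα1 : α ≤ 1)
    (lam beta : ℕ → ℝ) (hlam : ∀ n, 0 < lam n) (hbeta : ∀ n, 0 < beta n)
    (x : ℕ → H) (hx : IPA K f g α lam beta x)
    (hbdd : ∃ M : ℝ, ∀ n, ‖x n‖ ≤ M)
    (hstep : Filter.Tendsto (fun n => ‖x (n + 1) - x n‖) Filter.atTop (nhds 0))
    (hinert : Filter.Tendsto
      (fun n => ‖x (n + 1) - (x n + α • (x n - x (n - 1)))‖) Filter.atTop (nhds 0))
    (hbetaTop : Filter.Tendsto beta Filter.atTop Filter.atTop)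
    (hlaminf : ∃ c > (0 : ℝ), ∀ᶠ n in Filter.atTop, c ≤ lam n) :
    ∀ xb : H, ∀ φ : ℕ → ℕ, StrictMono φ →
      (∀ z : H, Filter.Tendsto (fun k => ⟪x (φ k), z⟫) Filter.atTop (nhds ⟪xb, z⟫)) →
      xb ∈ Sf K f := by
  intro xb φ hφ hw
  have hxbK : xb ∈ K := mem_of_isClosed_convex_of_tendsto_inner hKcl hKcv hw
    (.of_forall fun k => hx.1 (φ k))
  refine mem_Sf_of_forall_nonpos hKcv hfUHC hfEq hxbK fun y hy => ?_
  refine le_of_forall_pos_le_add fun ε hε => ?_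
  rw [zero_add]
  obtain ⟨-, hcv, hlsc⟩ := hfEq y hy
  have hcl : IsClosed {z ∈ K | f y z ≤ ε} := by
    obtain ⟨v, hv, hKv⟩ := lowerSemicontinuousOn_iff_preimage_Iic.1 hlsc ε
    have : {z ∈ K | f y z ≤ ε} = K ∩ v := hKv
    rw [this]
    exact hKcl.inter hv
  have hev := hx.eventually_le hfmono hgmono hgsub hbdd hinert hbetaTop hlaminf hy hε
  exact (mem_of_isClosed_convex_of_tendsto_inner hcl (hcv.convex_le ε) hw
    ((hφ.tendsto_atTop.eventually hev).mono fun k hk => ⟨hx.1 _, hk⟩)).2
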